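/- arXiv:1505.00952 — 2 statements merged into one kernel-verified Lean document; each statement's English description precedes it below -/
import Mathlib

section
/- Suppose A has at least three members (n ≥ 3), the A-neighbours aᵢ and a_{i+1} are M-neighbours, and A′ and M′ are obtained from A and M respectively by omitting aᵢ and a_{i+1}. If A ∥_M B, then A′ ∥_{M′} B. -/
/-- `x` precedes `y` in the list `M` (`x <_M y`). -/
def ltL (M : List ℕ) (x y : ℕ) : Prop :=
  ∃ i j : ℕ, i < j ∧ M[i]? = some x ∧ M[j]? = some y

/-- `M : x−y−z`: the distinct members `x`, `y`, `z` occur in `M` in that order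
or in the reverse order. -/
def BtwL (M : List ℕ) (x y z : ℕ) : Prop :=
  (ltL M x y ∧ ltL M y z) ∨ (ltL M z y ∧ ltL M y x)

/-- `x` and `y` are `L`-neighbours: one is the immediate predecessor of the
other in `L`. -/
def Neighb (L : List ℕ) (x y : ℕ) : Prop :=
  ∃ i : ℕ, (L[i]? = some x ∧ L[i + 1]? = some y) ∨ (L[i]? = some y ∧ L[i + 1]? = some x)

/-- The immediate successor of `v` in the list `F` (if it exists). -/
def succIn (F : List ℕ) (v : ℕ) : Option ℕ :=
  if v ∈ F then F[F.idxOf v + 1]? else none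

/-- The immediate predecessor of `v` in the list `F` (if it exists). -/
def predIn (F : List ℕ) (v : ℕ) : Option ℕ :=
  if v ∈ F ∧ F.idxOf v ≠ 0 then F[F.idxOf v - 1]? else none

/-- `u` and `v` are of the same parity: their indices (given by `idx`) are both
even or both odd. -/
def SameParity (idx : ℕ → ℕ) (u v : ℕ) : Prop := idx u % 2 = idx v % 2

/-- `M[v, u, vˢ]`: the member `u` (whose own list is `Fu`) is interlaced in `M`
with `v` and its immediate successor `vˢ` in the list `Fv`. -/
def Interlaced (M : List ℕ) (idx : ℕ → ℕ) (Fu Fv : List ℕ) (u v : ℕ) : Prop :=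
  u ≠ v ∧ ∃ vs, succIn Fv v = some vs ∧ BtwL M v u vs ∧
    (SameParity idx u vs → ∀ up, predIn Fu u = some up → ¬ BtwL M v up vs) ∧
    (SameParity idx u v → ∀ us, succIn Fu u = some us → ¬ BtwL M v us vs)

/-- `F ∥_M G`: no member of `F` is interlaced in `M` with two successive members
of `G`, and no member of `G` is interlaced in `M` with two successive members
of `F`. -/
def Parallel (M : List ℕ) (idx : ℕ → ℕ) (F G : List ℕ) : Prop :=
  (∀ u ∈ F, ∀ v ∈ G, ¬ Interlaced M idx F G u v) ∧
  (∀ u ∈ G, ∀ v ∈ F, ¬ Interlaced M idx G F u v)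

theorem ltL_iff_sublist (M : List ℕ) (hM : M.Nodup) (x y : ℕ) :
    ltL M x y ↔ x ∈ M ∧ y ∈ M ∧ M.idxOf x < M.idxOf y := by
  constructor
  · rintro ⟨i, j, hij, hi, hj⟩
    obtain ⟨hi', rfl⟩ := List.getElem?_eq_some_iff.1 hi
    obtain ⟨hj', rfl⟩ := List.getElem?_eq_some_iff.1 hj
    refine ⟨List.getElem_mem _, List.getElem_mem _, ?_⟩
    rw [hM.idxOf_getElem, hM.idxOf_getElem]
    exact hij
  · rintro ⟨hx, hy, h⟩
    refine ⟨_, _, h, ?_, ?_⟩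
    · exact List.getElem?_idxOf hx
    · exact List.getElem?_idxOf hy

theorem ltL_iff_pair (M : List ℕ) (x y : ℕ) :
    ltL M x y ↔ [x, y].Sublist M := by
  constructor
  · rintro ⟨i, j, hij, hi, hj⟩
    have h1 : x ∈ M.take (i + 1) :=
      List.mem_of_getElem? (i := i) (by rw [List.getElem?_take_of_lt (by omega), hi])
    have h2 : y ∈ M.drop (i + 1) :=
      List.mem_of_getElem? (i := j - (i + 1)) (by
        rw [List.getElem?_drop, Nat.add_sub_cancel' (by omega), hj])
    have h3 := (List.singleton_sublist.2 h1).append (List.singleton_sublist.2 h2)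
    rw [List.take_append_drop] at h3
    exact h3
  · intro h
    rw [List.sublist_iff_exists_orderEmbedding_getElem?_eq] at h
    obtain ⟨f, hf⟩ := h
    exact ⟨f 0, f 1, by simp, by simpa using (hf 0).symm, by simpa using (hf 1).symm⟩

theorem ltL_erase (M : List ℕ) (a x y : ℕ) (hx : x ≠ a) (hy : y ≠ a) :
    ltL (M.erase a) x y ↔ ltL M x y := by
  rw [ltL_iff_pair, ltL_iff_pair]
  constructor
  · intro h
    exact h.trans List.erase_sublist
  · intro h
    have := h.erase a
    rwa [List.erase_of_not_mem (by simp; tauto)] at this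

def SuccR (F : List ℕ) (x y : ℕ) : Prop := ∃ i, F[i]? = some x ∧ F[i+1]? = some y

theorem getElem?_idxOf_eq {F : List ℕ} (hF : F.Nodup) {i x : ℕ} (h : F[i]? = some x) :
    F.idxOf x = i := by
  obtain ⟨hi', rfl⟩ := List.getElem?_eq_some_iff.1 h
  exact hF.idxOf_getElem _ _

theorem succIn_iff {F : List ℕ} (hF : F.Nodup) (x y : ℕ) :
    succIn F x = some y ↔ SuccR F x y := by
  unfold succIn SuccR
  constructor
  · intro h
    split_ifs at h with hx
    exact ⟨_, List.getElem?_idxOf hx, h⟩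
  · rintro ⟨i, hi, hj⟩
    rw [if_pos (List.mem_of_getElem? hi), getElem?_idxOf_eq hF hi, hj]

theorem predIn_iff {F : List ℕ} (hF : F.Nodup) (x y : ℕ) :
    predIn F x = some y ↔ SuccR F y x := by
  unfold predIn SuccR
  constructor
  · intro h
    split_ifs at h with hx
    refine ⟨_, h, ?_⟩
    rw [Nat.sub_add_cancel (by omega)]
    exact List.getElem?_idxOf hx.1
  · rintro ⟨i, hi, hj⟩
    rw [getElem?_idxOf_eq hF hj, if_pos ⟨List.mem_of_getElem? hj, by omega⟩]
    simpa using hi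

theorem getElem?_omit (A : List ℕ) (p j : ℕ) (hp : p ≤ A.length) :
    (A.take p ++ A.drop (p + 2))[j]? = if j < p then A[j]? else A[j + 2]? := by
  rw [List.getElem?_append, List.length_take, min_eq_left hp]
  split_ifs with h
  · rw [List.getElem?_take_of_lt h]
  · rw [List.getElem?_drop]
    congr 1
    omega

theorem notI {M : List ℕ} {idx : ℕ → ℕ} {F G : List ℕ} (hF : F.Nodup) (hG : G.Nodup)
    {u v vs : ℕ} (h : ¬ Interlaced M idx F G u v) (huv : u ≠ v) (hs : SuccR G v vs)
    (hb : BtwL M v u vs) :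
    (idx u % 2 = idx vs % 2 ∧ ∃ up, SuccR F up u ∧ BtwL M v up vs) ∨
    (idx u % 2 = idx v % 2 ∧ ∃ us, SuccR F u us ∧ BtwL M v us vs) := by
  by_contra hc
  rw [not_or] at hc
  apply h
  refine ⟨huv, vs, (succIn_iff hG _ _).2 hs, hb, ?_, ?_⟩
  · intro hp up hup hb'
    exact hc.1 ⟨hp, up, (predIn_iff hF _ _).1 hup, hb'⟩
  · intro hp up hup hb'
    exact hc.2 ⟨hp, up, (succIn_iff hF _ _).1 hup, hb'⟩

set_option maxHeartbeats 2000000 in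
/-- **Lemma 2.1.1.1**: with `A = a_{k+1}…a_{k+n}` (`n ≥ 3`) and
`B = b_{l+1}…b_{l+m}` disjoint, `M` a list of their union, if the
`A`-neighbours `aᵢ = A[p]` and `a_{i+1} = A[p+1]` are also `M`-neighbours, and
`A′`, `M′` are obtained by omitting them from `A` and `M`, then `A ∥_M B`
implies `A′ ∥_{M′} B`. -/
theorem parallel_of_omit (A B M : List ℕ) (k l n m : ℕ) (idx : ℕ → ℕ)
    (hAlen : A.length = n) (hBlen : B.length = m) (hn : 3 ≤ n) (hm : 1 ≤ m)
    (hAnd : A.Nodup) (hBnd : B.Nodup) (hAB : A.Disjoint B)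
    (hMnd : M.Nodup) (hM : ∀ x, x ∈ M ↔ x ∈ A ∨ x ∈ B)
    (hiA : ∀ (i x : ℕ), A[i]? = some x → idx x = k + 1 + i)
    (hiB : ∀ (j x : ℕ), B[j]? = some x → idx x = l + 1 + j)
    (p : ℕ) (ai ai1 : ℕ) (hai : A[p]? = some ai) (hai1 : A[p + 1]? = some ai1)
    (hMnb : Neighb M ai ai1)
    (hpar : Parallel M idx A B) :
    Parallel ((M.erase ai).erase ai1) idx (A.take p ++ A.drop (p + 2)) B := by
  have hp2 : p + 1 < A.length := (List.getElem?_eq_some_iff.1 hai1).1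
  have hA'g := fun j => getElem?_omit A p j (by omega)
  have hA'nd : (A.take p ++ A.drop (p + 2)).Nodup := by
    refine List.Sublist.nodup ?_ hAnd
    conv_rhs => rw [← List.take_append_drop p A]
    refine List.Sublist.append_left ?_ _
    rw [← List.drop_drop]
    exact List.drop_sublist _ _
  generalize hA' : A.take p ++ A.drop (p + 2) = A' at *
  have hinj : ∀ (i j x : ℕ), A[i]? = some x → A[j]? = some x → i = j := by
    intro i j x hi hj
    have := hiA _ _ hi
    have := hiA _ _ hj
    omega
  have hSA : ∀ x y, SuccR A' x y →
      (SuccR A x y) ∨ (SuccR A x ai ∧ SuccR A ai1 y) := by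
    rintro x y ⟨i, hi, hj⟩
    rw [hA'g] at hi hj
    by_cases h1 : i + 1 < p
    · rw [if_pos (by omega)] at hi hj
      exact Or.inl ⟨i, hi, hj⟩
    · by_cases h2 : i < p
      · have : p = i + 1 := by omega
        subst this
        rw [if_pos (by omega)] at hi
        rw [if_neg (by omega)] at hj
        exact Or.inr ⟨⟨i, hi, hai⟩, ⟨i + 2, hai1, hj⟩⟩
      · rw [if_neg (by omega)] at hi hj
        exact Or.inl ⟨i + 2, hi, hj⟩
  have hSA2 : ∀ x y, x ≠ ai → x ≠ ai1 → y ≠ ai → y ≠ ai1 → SuccR A x y → SuccR A' x y := by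
    rintro x y h1 h2 h3 h4 ⟨i, hi, hj⟩
    have e1 : i ≠ p := by rintro rfl; rw [hai] at hi; simp_all
    have e2 : i ≠ p + 1 := by rintro rfl; rw [hai1] at hi; simp_all
    have e3 : i + 1 ≠ p := by rintro rfl; rw [hai] at hj; simp_all
    by_cases h : i < p
    · exact ⟨i, by rw [hA'g, if_pos h, hi], by rw [hA'g, if_pos (by omega), hj]⟩
    · obtain ⟨t, rfl⟩ : ∃ t, i = t + 2 := ⟨i - 2, by omega⟩
      exact ⟨t, by rw [hA'g, if_neg (by omega), hi], by rw [hA'g, if_neg (by omega), hj]⟩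
  have hSA3 : ∀ x y, SuccR A x ai → SuccR A ai1 y → SuccR A' x y := by
    rintro x y ⟨i, hi, hi'⟩ ⟨j, hj, hj'⟩
    have e1 := hinj _ _ _ hi' hai
    have e2 := hinj _ _ _ hj hai1
    subst e1; subst e2
    exact ⟨i, by rw [hA'g, if_pos (by omega), hi], by rw [hA'g, if_neg (by omega)]; exact hj'⟩
  have hS01 : SuccR A ai ai1 := ⟨p, hai, hai1⟩
  have hmA' : ∀ x, x ∈ A' → x ∈ A ∧ x ≠ ai ∧ x ≠ ai1 := by
    intro x hx
    obtain ⟨j, hj⟩ := List.mem_iff_getElem?.1 hx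
    rw [hA'g] at hj
    split_ifs at hj with h
    · refine ⟨List.mem_of_getElem? hj, ?_, ?_⟩ <;> rintro rfl
      · have := hinj _ _ _ hj hai; omega
      · have := hinj _ _ _ hj hai1; omega
    · refine ⟨List.mem_of_getElem? hj, ?_, ?_⟩ <;> rintro rfl
      · have := hinj _ _ _ hj hai; omega
      · have := hinj _ _ _ hj hai1; omega
  have hSAm : ∀ F x y, SuccR F x y → x ∈ F ∧ y ∈ F := by
    rintro F x y ⟨i, hi, hj⟩
    exact ⟨List.mem_of_getElem? hi, List.mem_of_getElem? hj⟩
  have hAu : ∀ x y z, SuccR A x y → SuccR A x z → y = z := by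
    rintro x y z ⟨i, hi, hi'⟩ ⟨j, hj, hj'⟩
    have := hinj _ _ _ hi hj
    subst this
    rw [hi'] at hj'; simpa using hj'
  have hAu2 : ∀ x y z, SuccR A y x → SuccR A z x → y = z := by
    rintro x y z ⟨i, hi, hi'⟩ ⟨j, hj, hj'⟩
    have := hinj _ _ _ hi' hj'
    have : i = j := by omega
    subst this
    rw [hi] at hj; simpa using hj
  have hBu : ∀ x y z, SuccR B x y → SuccR B x z → y = z := by
    intro x y z h1 h2
    rw [← succIn_iff hBnd] at h1 h2
    rw [h1] at h2; simpa using h2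
  have hBu2 : ∀ x y z, SuccR B y x → SuccR B z x → y = z := by
    intro x y z h1 h2
    rw [← predIn_iff hBnd] at h1 h2
    rw [h1] at h2; simpa using h2
  have hiSA : ∀ x y, SuccR A x y → idx y = idx x + 1 := by
    rintro x y ⟨i, hi, hi'⟩
    rw [hiA _ _ hi, hiA _ _ hi']; omega
  have hiSB : ∀ x y, SuccR B x y → idx y = idx x + 1 := by
    rintro x y ⟨i, hi, hi'⟩
    rw [hiB _ _ hi, hiB _ _ hi']; omega
  have haiA : ai ∈ A := (hSAm _ _ _ hS01).1
  have hai1A : ai1 ∈ A := (hSAm _ _ _ hS01).2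
  -- positions
  obtain ⟨P, hP⟩ : ∃ P : ℕ → ℕ, P = fun x => M.idxOf x := ⟨_, rfl⟩
  have hPinj : ∀ x y, x ∈ M → P x = P y → x = y := by
    intro x y hx h
    rw [hP] at h
    exact (List.idxOf_inj hx).1 h
  have hadj : P ai1 = P ai + 1 ∨ P ai = P ai1 + 1 := by
    obtain ⟨i, h | h⟩ := hMnb
    · left
      rw [hP]; simp only
      rw [getElem?_idxOf_eq hMnd h.1, getElem?_idxOf_eq hMnd h.2]
    · right
      rw [hP]; simp only
      rw [getElem?_idxOf_eq hMnd h.1, getElem?_idxOf_eq hMnd h.2]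
  have hBt : ∀ x y z, x ∈ M → y ∈ M → z ∈ M → (BtwL M x y z ↔
      (P x < P y ∧ P y < P z) ∨ (P z < P y ∧ P y < P x)) := by
    intro x y z hx hy hz
    unfold BtwL
    simp only [ltL_iff_sublist M hMnd, hP, hx, hy, hz, true_and]
  have hBt' : ∀ x y z, x ≠ ai → x ≠ ai1 → y ≠ ai → y ≠ ai1 → z ≠ ai → z ≠ ai1 →
      (BtwL ((M.erase ai).erase ai1) x y z ↔ BtwL M x y z) := by
    intro x y z h1 h2 h3 h4 h5 h6
    unfold BtwL
    rw [ltL_erase _ _ _ _ h2 h4, ltL_erase _ _ _ _ h4 h6, ltL_erase _ _ _ _ h6 h4,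
      ltL_erase _ _ _ _ h4 h2, ltL_erase _ _ _ _ h1 h3, ltL_erase _ _ _ _ h3 h5,
      ltL_erase _ _ _ _ h5 h3, ltL_erase _ _ _ _ h3 h1]
  have hAM : ∀ x ∈ A, x ∈ M := fun x hx => (hM x).2 (Or.inl hx)
  have hBM : ∀ x ∈ B, x ∈ M := fun x hx => (hM x).2 (Or.inr hx)
  have hABne : ∀ x ∈ A, ∀ y ∈ B, x ≠ y := by
    rintro x hx y hy rfl
    exact hAB hx hy
  have hadjw : ∀ w ∈ M, w ≠ ai → w ≠ ai1 →
      (P w < P ai ∧ P w < P ai1) ∨ (P ai < P w ∧ P ai1 < P w) := by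
    intro w hw h1 h2
    have : P w ≠ P ai := fun h => h1 (hPinj w ai hw h)
    have : P w ≠ P ai1 := fun h => h2 (hPinj w ai1 hw h)
    omega
  have hadjB : ∀ w ∈ B, (P w < P ai ∧ P w < P ai1) ∨ (P ai < P w ∧ P ai1 < P w) :=
    fun w hw => hadjw w (hBM w hw) (hABne _ haiA _ hw).symm (hABne _ hai1A _ hw).symm
  constructor
  · rintro u hu v hv ⟨huv, vs, hvs, hb, h1, h2⟩
    rw [succIn_iff hBnd] at hvs
    obtain ⟨huA, hu1, hu2⟩ := hmA' u hu
    have hvs' := (hSAm _ _ _ hvs).2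
    have hv1 := (hABne _ haiA _ hv).symm
    have hv2 := (hABne _ hai1A _ hv).symm
    have hw1 := (hABne _ haiA _ hvs').symm
    have hw2 := (hABne _ hai1A _ hvs').symm
    have hBe : ∀ y, y ≠ ai → y ≠ ai1 →
        (BtwL ((M.erase ai).erase ai1) v y vs ↔ BtwL M v y vs) :=
      fun y hy hy' => hBt' v y vs hv1 hv2 hy hy' hw1 hw2
    rw [hBe u hu1 hu2] at hb
    have hBeq : BtwL M v ai vs ↔ BtwL M v ai1 vs := by
      rw [hBt _ _ _ (hBM _ hv) (hAM _ haiA) (hBM _ hvs'),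
        hBt _ _ _ (hBM _ hv) (hAM _ hai1A) (hBM _ hvs')]
      have := hadjB v hv
      have := hadjB vs hvs'
      omega
    have hpv := hiSB _ _ hvs
    have hp01 := hiSA _ _ hS01
    have key := fun x hx => notI (u := x) hAnd hBnd (hpar.1 x hx v hv) (hABne _ hx _ hv) hvs
    unfold SameParity at h1 h2
    rcases key u huA hb with ⟨hq, up, hup, hbu⟩ | ⟨hq, us, hus, hbu⟩
    · have hne : up ≠ ai := by
        rintro rfl; exact hu2 (hAu _ _ _ hup hS01)
      by_cases hup1 : up = ai1
      · subst hup1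
        have hpu := hiSA _ _ hup
        rcases key ai haiA (hBeq.2 hbu) with ⟨hq', w, hw, hbw⟩ | ⟨hq', w, hw, hbw⟩
        · have hS' := hSA3 _ _ hw hup
          have hn := hmA' _ (hSAm _ _ _ hS').1
          exact h1 hq w ((predIn_iff hA'nd _ _).2 hS') ((hBe w hn.2.1 hn.2.2).2 hbw)
        · omega
      · exact h1 hq up ((predIn_iff hA'nd _ _).2 (hSA2 _ _ hne hup1 hu1 hu2 hup))
          ((hBe up hne hup1).2 hbu)
    · have hne : us ≠ ai1 := by
        rintro rfl; exact hu1 (hAu2 _ _ _ hus hS01)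
      by_cases hup1 : us = ai
      · subst hup1
        have hpu := hiSA _ _ hus
        rcases key ai1 hai1A (hBeq.1 hbu) with ⟨hq', w, hw, hbw⟩ | ⟨hq', w, hw, hbw⟩
        · omega
        · have hS' := hSA3 _ _ hus hw
          have hn := hmA' _ (hSAm _ _ _ hS').2
          exact h2 hq w ((succIn_iff hA'nd _ _).2 hS') ((hBe w hn.2.1 hn.2.2).2 hbw)
      · exact h2 hq us ((succIn_iff hA'nd _ _).2 (hSA2 _ _ hu1 hu2 hup1 hne hus))
          ((hBe us hup1 hne).2 hbu)
  · rintro u hu v hv ⟨huv, vs, hvs, hb, h1, h2⟩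
    rw [succIn_iff hA'nd] at hvs
    obtain ⟨hvA, hv1, hv2⟩ := hmA' v hv
    obtain ⟨hwA, hw1, hw2⟩ := hmA' vs (hSAm _ _ _ hvs).2
    have hBe : ∀ y ∈ B,
        (BtwL ((M.erase ai).erase ai1) v y vs ↔ BtwL M v y vs) :=
      fun y hy => hBt' v y vs hv1 hv2 (hABne _ haiA _ hy).symm (hABne _ hai1A _ hy).symm hw1 hw2
    rw [hBe u hu] at hb
    unfold SameParity at h1 h2
    have g1 : idx u % 2 = idx vs % 2 → ∀ up, SuccR B up u → ¬ BtwL M v up vs := by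
      intro h up hup
      rw [← hBe up (hSAm _ _ _ hup).1]
      exact h1 h up ((predIn_iff hBnd _ _).2 hup)
    have g2 : idx u % 2 = idx v % 2 → ∀ up, SuccR B u up → ¬ BtwL M v up vs := by
      intro h up hup
      rw [← hBe up (hSAm _ _ _ hup).2]
      exact h2 h up ((succIn_iff hBnd _ _).2 hup)
    have key := fun x hx a b (hab : SuccR A a b) =>
      notI (u := x) hBnd hAnd (hpar.2 x hx a (hSAm _ _ _ hab).1)
        (hABne _ (hSAm _ _ _ hab).1 _ hx).symm hab
    rcases hSA _ _ hvs with hs | ⟨hs, hs'⟩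
    · rcases key u hu _ _ hs hb with ⟨hq, w, hw, hbw⟩ | ⟨hq, w, hw, hbw⟩
      · exact g1 hq w hw hbw
      · exact g2 hq w hw hbw
    · have i1 := hiSA _ _ hs
      have i2 := hiSA _ _ hs'
      have i3 := hiSA _ _ hS01
      have B1 : ∀ x ∈ B, (BtwL M v x vs ↔ (P v < P x ∧ P x < P vs) ∨ (P vs < P x ∧ P x < P v)) :=
        fun x hx => hBt _ _ _ (hAM _ hvA) (hBM _ hx) (hAM _ hwA)
      have B2 : ∀ x ∈ B, (BtwL M v x ai ↔ (P v < P x ∧ P x < P ai) ∨ (P ai < P x ∧ P x < P v)) :=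
        fun x hx => hBt _ _ _ (hAM _ hvA) (hBM _ hx) (hAM _ haiA)
      have B3 : ∀ x ∈ B, (BtwL M ai1 x vs ↔
          (P ai1 < P x ∧ P x < P vs) ∨ (P vs < P x ∧ P x < P ai1)) :=
        fun x hx => hBt _ _ _ (hAM _ hai1A) (hBM _ hx) (hAM _ hwA)
      have jv := hadjw v (hAM _ hvA) hv1 hv2
      have jw := hadjw vs (hAM _ hwA) hw1 hw2
      have ju := hadjB u hu
      have dv : ∀ x ∈ B, P x ≠ P v := fun x hx h => hABne v hvA x hx (hPinj _ _ (hBM _ hx) h).symm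
      have dw : ∀ x ∈ B, P x ≠ P vs := fun x hx h => hABne vs hwA x hx (hPinj _ _ (hBM _ hx) h).symm
      -- for B-members: between v,vs iff exactly one of the other two
      have tri : ∀ x ∈ B, BtwL M v x vs → (BtwL M v x ai ∧ ¬ BtwL M ai1 x vs) ∨
          (¬ BtwL M v x ai ∧ BtwL M ai1 x vs) := by
        intro x hx
        rw [B1 x hx, B2 x hx, B3 x hx]
        have := hadjB x hx
        omega
      have tri2 : ∀ x ∈ B, ¬ BtwL M v x vs → (BtwL M v x ai ↔ BtwL M ai1 x vs) := by
        intro x hx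
        rw [B1 x hx, B2 x hx, B3 x hx]
        have := hadjB x hx
        have := dv x hx
        have := dw x hx
        omega
      rcases tri u hu hb with ⟨c1, c2⟩ | ⟨c1, c2⟩
      · rcases key u hu _ _ hs c1 with ⟨hq, w, hw, hbw⟩ | ⟨hq, w, hw, hbw⟩
        · have hwB := (hSAm _ _ _ hw).1
          have iw := hiSB _ _ hw
          have hn := g1 (by omega) w hw
          rcases key w hwB _ _ hs' ((tri2 w hwB hn).1 hbw) with ⟨hq', z, hz, hbz⟩ | ⟨hq', z, hz, hbz⟩
          · omega
          · exact c2 (hBu _ _ _ hz hw ▸ hbz)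
        · have hwB := (hSAm _ _ _ hw).2
          have iw := hiSB _ _ hw
          have hn := g2 (by omega) w hw
          rcases key w hwB _ _ hs' ((tri2 w hwB hn).1 hbw) with ⟨hq', z, hz, hbz⟩ | ⟨hq', z, hz, hbz⟩
          · exact c2 (hBu2 _ _ _ hz hw ▸ hbz)
          · omega
      · rcases key u hu _ _ hs' c2 with ⟨hq, w, hw, hbw⟩ | ⟨hq, w, hw, hbw⟩
        · have hwB := (hSAm _ _ _ hw).1
          have iw := hiSB _ _ hw
          have hn := g1 (by omega) w hw
          rcases key w hwB _ _ hs ((tri2 w hwB hn).2 hbw) with ⟨hq', z, hz, hbz⟩ | ⟨hq', z, hz, hbz⟩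
          · omega
          · exact c1 (hBu _ _ _ hz hw ▸ hbz)
        · have hwB := (hSAm _ _ _ hw).2
          have iw := hiSB _ _ hw
          have hn := g2 (by omega) w hw
          rcases key w hwB _ _ hs ((tri2 w hwB hn).2 hbw) with ⟨hq', z, hz, hbz⟩ | ⟨hq', z, hz, hbz⟩
          · exact c1 (hBu2 _ _ _ hz hw ▸ hbz)
          · omega
end

section
/- Assume A ∥_M B, A ∥_M A and B ∥_M B. If a_{k+1} ≡_Π b_{l+1} and n and m are both odd, then a_{k+1} <_M b_{l+1} if and only if a_{k+n} <_M b_{l+m}. -/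
theorem sum_odd_left (g : ℕ → ZMod 2) (r : ℕ) (h : ∀ t < r, g (2*t+1) = g (2*t+2)) :
    ∑ j ∈ Finset.range (2*r+1), g j = g 0 := by
  induction r with
  | zero => simp
  | succ r ih =>
    rw [show 2*(r+1)+1 = (2*r+1)+1+1 by ring, Finset.sum_range_succ, Finset.sum_range_succ,
      ih (fun t ht => h t (by omega)), h r (by omega), add_assoc, CharTwo.add_self_eq_zero, add_zero]

theorem sum_odd_right (g : ℕ → ZMod 2) (r : ℕ) (h : ∀ t < r, g (2*t) = g (2*t+1)) :
    ∑ j ∈ Finset.range (2*r+1), g j = g (2*r) := by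
  induction r with
  | zero => simp
  | succ r ih =>
    rw [show 2*(r+1)+1 = (2*r+1)+1+1 by ring, Finset.sum_range_succ, Finset.sum_range_succ,
      ih (fun t ht => h t (by omega)), h r (by omega), CharTwo.add_self_eq_zero, zero_add]
    rfl

/-- strictly between -/
def Bt (x y z : ℕ) : Prop := (x < y ∧ y < z) ∨ (z < y ∧ y < x)

open Classical in
/-- mod 2 indicator -/
noncomputable def ind (p : Prop) : ZMod 2 := if p then 1 else 0

theorem ind_congr {p q : Prop} (h : p ↔ q) : ind p = ind q := by rw [propext h]

theorem ind_inj {p q : Prop} (h : ind p = ind q) : p ↔ q := by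
  unfold ind at h
  by_cases hp : p <;> by_cases hq : q <;> simp_all

theorem ind_bt (x y z : ℕ) (h1 : y ≠ x) (h2 : y ≠ z) :
    ind (Bt x y z) = ind (y < x) + ind (y < z) := by
  have h11 : (1 : ZMod 2) + 1 = 0 := by decide
  rcases lt_or_gt_of_ne h1 with h1 | h1 <;> rcases lt_or_gt_of_ne h2 with h2 | h2 <;>
    simp [ind, Bt, h1, h2, h1.not_gt, h2.not_gt, h11]

theorem core (a b : ℕ → ℕ) (n r : ℕ) (hn : n % 2 = 1)
    (hne : ∀ i < n, ∀ j < 2*r+1, b j ≠ a i)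
    (H1 : ∀ i, i + 1 < n → ∀ j < 2*r+1, Bt (a i) (b j) (a (i+1)) →
      (j % 2 ≠ i % 2 ∧ 1 ≤ j ∧ Bt (a i) (b (j-1)) (a (i+1))) ∨
      (j % 2 = i % 2 ∧ j + 1 < 2*r+1 ∧ Bt (a i) (b (j+1)) (a (i+1))))
    (H2 : ∀ j, j + 1 < 2*r+1 → ∀ i < n, Bt (b j) (a i) (b (j+1)) →
      (i % 2 ≠ j % 2 ∧ 1 ≤ i) ∨ (i % 2 = j % 2 ∧ i + 1 < n)) :
    b 0 < a 0 ↔ b (2*r) < a (n-1) := by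
  have hstep : ∀ i < n, ∑ j ∈ Finset.range (2*r+1), ind (b j < a i)
      = ∑ j ∈ Finset.range (2*r+1), ind (b j < a 0) := by
    intro i
    induction i with
    | zero => intro; rfl
    | succ i ih =>
      intro hi
      rw [← ih (by omega), ← sub_eq_zero, CharTwo.sub_eq_add, add_comm, ← Finset.sum_add_distrib]
      rw [Finset.sum_congr rfl (g := fun j => ind (Bt (a i) (b j) (a (i+1))))]
      · rcases Nat.mod_two_eq_zero_or_one i with h0 | h0
        · rw [sum_odd_right]
          · refine if_neg ?_
            intro h
            have := H1 i hi _ (by omega) h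
            omega
          · intro t ht
            refine ind_congr ⟨fun h => ?_, fun h => ?_⟩
            · rcases H1 i hi _ (by omega) h with h | h
              · omega
              · exact h.2.2
            · rcases H1 i hi _ (by omega) h with h | h
              · exact h.2.2
              · omega
        · rw [sum_odd_left]
          · refine if_neg ?_
            intro h
            have := H1 i hi _ (by omega) h
            omega
          · intro t ht
            refine ind_congr ⟨fun h => ?_, fun h => ?_⟩
            · rcases H1 i hi _ (by omega) h with h | h
              · omega
              · exact h.2.2
            · rcases H1 i hi _ (by omega) h with h | h
              · exact h.2.2
              · omega
      · intro j hj
        rw [Finset.mem_range] at hj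
        exact (ind_bt _ _ _ (hne _ (by omega) _ hj) (hne _ hi _ hj)).symm
  have h := hstep (n-1) (by omega)
  rw [sum_odd_left (fun j => ind (b j < a 0)), sum_odd_right (fun j => ind (b j < a (n-1)))] at h
  · exact (ind_inj h).symm
  · intro t ht
    have h1 := hne (n-1) (by omega) (2*t) (by omega)
    have h2 := hne (n-1) (by omega) (2*t+1) (by omega)
    have h3 := H2 (2*t) (by omega) (n-1) (by omega)
    unfold Bt at h3
    refine ind_congr ?_
    omega
  · intro t ht
    have h1 := hne 0 (by omega) (2*t+1) (by omega)
    have h2 := hne 0 (by omega) (2*t+2) (by omega)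
    have h3 := H2 (2*t+1) (by omega) 0 (by omega)
    unfold Bt at h3
    rw [show 2*t+1+1 = 2*t+2 by ring] at h3
    refine ind_congr ?_
    omega

theorem ltL_iff {M : List ℕ} (hM : M.Nodup) {x y : ℕ} (hx : x ∈ M) (hy : y ∈ M) :
    ltL M x y ↔ M.idxOf x < M.idxOf y := by
  constructor
  · rintro ⟨i, j, hij, h1, h2⟩
    obtain ⟨hi, rfl⟩ := List.getElem?_eq_some_iff.1 h1
    obtain ⟨hj, rfl⟩ := List.getElem?_eq_some_iff.1 h2
    rwa [hM.idxOf_getElem, hM.idxOf_getElem]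
  · intro h
    exact ⟨_, _, h, List.getElem?_idxOf hx, List.getElem?_idxOf hy⟩

theorem BtwL_iff {M : List ℕ} (hM : M.Nodup) {x y z : ℕ} (hx : x ∈ M) (hy : y ∈ M) (hz : z ∈ M) :
    BtwL M x y z ↔ Bt (M.idxOf x) (M.idxOf y) (M.idxOf z) := by
  unfold BtwL Bt
  rw [ltL_iff hM hx hy, ltL_iff hM hy hz, ltL_iff hM hz hy, ltL_iff hM hy hx]

theorem extract (F G M : List ℕ) (idx : ℕ → ℕ) (p q : ℕ) (hF : F.Nodup) (hG : G.Nodup)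
    (hd : F.Disjoint G) (hM : M.Nodup) (hFM : ∀ x ∈ F, x ∈ M) (hGM : ∀ x ∈ G, x ∈ M)
    (hiF : ∀ (i x : ℕ), F[i]? = some x → idx x = p + 1 + i)
    (hiG : ∀ (i x : ℕ), G[i]? = some x → idx x = q + 1 + i)
    (hpq : p % 2 = q % 2)
    (hP : ∀ u ∈ F, ∀ v ∈ G, ¬ Interlaced M idx F G u v) :
    ∀ i, i + 1 < G.length → ∀ j < F.length,
      Bt (M.idxOf (G.getD i 0)) (M.idxOf (F.getD j 0)) (M.idxOf (G.getD (i+1) 0)) →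
      (j % 2 ≠ i % 2 ∧ 1 ≤ j ∧
        Bt (M.idxOf (G.getD i 0)) (M.idxOf (F.getD (j-1) 0)) (M.idxOf (G.getD (i+1) 0))) ∨
      (j % 2 = i % 2 ∧ j + 1 < F.length ∧
        Bt (M.idxOf (G.getD i 0)) (M.idxOf (F.getD (j+1) 0)) (M.idxOf (G.getD (i+1) 0))) := by
  intro i hi j hj hb
  have hi0 : i < G.length := by omega
  have gm : ∀ t (h : t < G.length), G[t] ∈ M := fun t h => hGM _ (List.getElem_mem h)
  have fm : ∀ t (h : t < F.length), F[t] ∈ M := fun t h => hFM _ (List.getElem_mem h)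
  rw [List.getD_eq_getElem _ _ hi, List.getD_eq_getElem _ _ hi0] at *
  rw [List.getD_eq_getElem _ _ hj] at hb
  by_contra hcon
  push Not at hcon
  refine hP _ (List.getElem_mem hj) _ (List.getElem_mem hi0) ⟨?_, G[i+1], ?_, ?_, ?_, ?_⟩
  · intro h
    exact hd (List.getElem_mem hj) (h ▸ List.getElem_mem hi0)
  · simp [succIn, hG.idxOf_getElem, hi]
  · exact (BtwL_iff hM (gm _ _) (fm _ _) (gm _ _)).2 hb
  · intro hs up hup hbt
    unfold SameParity at hs
    rw [hiF j _ (List.getElem?_eq_getElem hj), hiG (i+1) _ (List.getElem?_eq_getElem hi)] at hs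
    simp only [predIn, hF.idxOf_getElem, List.getElem_mem, true_and] at hup
    split_ifs at hup with h0
    obtain ⟨h1, rfl⟩ := List.getElem?_eq_some_iff.1 hup
    refine hcon.1 (by omega) (by omega) ?_
    rw [List.getD_eq_getElem _ _ h1]
    exact (BtwL_iff hM (gm _ _) (fm _ _) (gm _ _)).1 hbt
  · intro hs us hus hbt
    unfold SameParity at hs
    rw [hiF j _ (List.getElem?_eq_getElem hj), hiG i _ (List.getElem?_eq_getElem hi0)] at hs
    simp only [succIn, hF.idxOf_getElem, List.getElem_mem, if_true] at hus
    obtain ⟨h1, rfl⟩ := List.getElem?_eq_some_iff.1 hus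
    refine hcon.2 (by omega) h1 ?_
    rw [List.getD_eq_getElem _ _ h1]
    exact (BtwL_iff hM (gm _ _) (fm _ _) (gm _ _)).1 hbt

/-- **Lemma 2.1.4**: assuming `A ∥_M B`, `A ∥_M A` and `B ∥_M B`, if
`a_{k+1} ≡_Π b_{l+1}` and `n` and `m` are both odd, then
`a_{k+1} <_M b_{l+1}` iff `a_{k+n} <_M b_{l+m}`. -/
theorem first_lt_iff_last_lt (A B M : List ℕ) (k l n m : ℕ) (idx : ℕ → ℕ)
    (hAlen : A.length = n) (hBlen : B.length = m) (hn : 1 ≤ n) (hm : 1 ≤ m)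
    (hAnd : A.Nodup) (hBnd : B.Nodup) (hAB : A.Disjoint B)
    (hMnd : M.Nodup) (hM : ∀ x, x ∈ M ↔ x ∈ A ∨ x ∈ B)
    (hiA : ∀ (i x : ℕ), A[i]? = some x → idx x = k + 1 + i)
    (hiB : ∀ (j x : ℕ), B[j]? = some x → idx x = l + 1 + j)
    (hAB' : Parallel M idx A B) (hAA : Parallel M idx A A) (hBB : Parallel M idx B B)
    (a₁ aₙ b₁ bₘ : ℕ)
    (ha₁ : A[0]? = some a₁) (haₙ : A[n - 1]? = some aₙ)
    (hb₁ : B[0]? = some b₁) (hbₘ : B[m - 1]? = some bₘ)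
    (hpar : SameParity idx a₁ b₁)
    (hnodd : n % 2 = 1) (hmodd : m % 2 = 1) :
    ltL M a₁ b₁ ↔ ltL M aₙ bₘ := by
  have hAM : ∀ x ∈ A, x ∈ M := fun x h => (hM x).2 (Or.inl h)
  have hBM : ∀ x ∈ B, x ∈ M := fun x h => (hM x).2 (Or.inr h)
  have hkl : k % 2 = l % 2 := by
    unfold SameParity at hpar
    rw [hiA 0 _ ha₁, hiB 0 _ hb₁] at hpar
    omega
  have E1 := extract B A M idx l k hBnd hAnd hAB.symm hMnd hBM hAM hiB hiA hkl.symm hAB'.2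
  have E2 := extract A B M idx k l hAnd hBnd hAB hMnd hAM hBM hiA hiB hkl hAB'.1
  obtain ⟨r, rfl⟩ : ∃ r, m = 2*r+1 := ⟨m/2, by omega⟩
  rw [hAlen, hBlen] at E1 E2
  have hneq : ∀ x ∈ A, ∀ y ∈ B, M.idxOf y ≠ M.idxOf x := by
    intro x hx y hy h
    have := (List.idxOf_inj (hBM y hy)).1 h
    exact hAB hx (this ▸ hy)
  have hc := core (fun i => M.idxOf (A.getD i 0)) (fun i => M.idxOf (B.getD i 0)) n r hnodd
    (by
      intro i hi j hj
      rw [← hAlen] at hi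
      rw [← hBlen] at hj
      simp only [List.getD_eq_getElem _ _ hi, List.getD_eq_getElem _ _ hj]
      exact hneq _ (List.getElem_mem hi) _ (List.getElem_mem hj))
    E1
    (by
      intro j hj i hi h
      rcases E2 j hj i hi h with h | h
      · exact Or.inl ⟨h.1, h.2.1⟩
      · exact Or.inr ⟨h.1, h.2.1⟩)
  have e1 : A.getD 0 0 = a₁ := by rw [List.getD_eq_getElem?_getD, ha₁]; rfl
  have e2 : A.getD (n-1) 0 = aₙ := by rw [List.getD_eq_getElem?_getD, haₙ]; rfl
  have e3 : B.getD 0 0 = b₁ := by rw [List.getD_eq_getElem?_getD, hb₁]; rfl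
  have e4 : B.getD (2*r) 0 = bₘ := by
    rw [List.getD_eq_getElem?_getD, show 2*r = 2*r+1-1 by omega, hbₘ]; rfl
  simp only [e1, e2, e3, e4] at hc
  have m1 := List.mem_of_getElem? ha₁
  have m2 := List.mem_of_getElem? haₙ
  have m3 := List.mem_of_getElem? hb₁
  have m4 := List.mem_of_getElem? hbₘ
  rw [ltL_iff hMnd (hAM _ m1) (hBM _ m3), ltL_iff hMnd (hAM _ m2) (hBM _ m4)]
  have n1 := hneq _ m1 _ m3
  have n2 := hneq _ m2 _ m4
  omega
end
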